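/- For the ortho-toric Kähler structure determined by functions F, G of one variable (g = (ξ-η)(dξ²/F(ξ) - dη²/G(η)) + (ξ-η)⁻¹(F(ξ)(dt+η dz)² - G(η)(dt+ξ dz)²)), the normalized scalar curvature is s = -(F''(ξ) - G''(η))/(6(ξ-η)). -/

import Mathlib

noncomputable section

/-- Coordinates `(ξ, η, t, z)` on ℝ⁴. -/
abbrev V4 := Fin 4 → ℝ

/-- Partial derivative in the `i`-th coordinate direction. -/
def pd (i : Fin 4) (f : V4 → ℝ) (p : V4) : ℝ := fderiv ℝ f p (Pi.single i 1)

/-- Matrix of the ortho-toric metric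
`g = (ξ-η)(dξ²/F(ξ) - dη²/G(η)) + (ξ-η)⁻¹(F(ξ)(dt+η dz)² - G(η)(dt+ξ dz)²)`
in the coordinates `(ξ, η, t, z)`. -/
def gm (F G : ℝ → ℝ) (p : V4) : Matrix (Fin 4) (Fin 4) ℝ :=
  !![(p 0 - p 1) / F (p 0), 0, 0, 0;
     0, -((p 0 - p 1) / G (p 1)), 0, 0;
     0, 0, (F (p 0) - G (p 1)) / (p 0 - p 1),
       (F (p 0) * p 1 - G (p 1) * p 0) / (p 0 - p 1);
     0, 0, (F (p 0) * p 1 - G (p 1) * p 0) / (p 0 - p 1),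
       (F (p 0) * (p 1) ^ 2 - G (p 1) * (p 0) ^ 2) / (p 0 - p 1)]

/-- Christoffel symbols `Γ^k_{ij}` of the ortho-toric metric. -/
def Γ (F G : ℝ → ℝ) (k i j : Fin 4) (p : V4) : ℝ :=
  (1 / 2) * ∑ l, (gm F G p)⁻¹ k l *
    (pd i (fun q => gm F G q j l) p + pd j (fun q => gm F G q i l) p
      - pd l (fun q => gm F G q i j) p)

/-- Ricci curvature `R_{ij} = ∂_k Γ^k_{ij} - ∂_j Γ^k_{ik} + Γ^k_{kl}Γ^l_{ij} - Γ^k_{jl}Γ^l_{ik}`. -/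
def ricci (F G : ℝ → ℝ) (i j : Fin 4) (p : V4) : ℝ :=
  (∑ k, pd k (Γ F G k i j) p) - (∑ k, pd j (Γ F G k i k) p)
    + (∑ k, ∑ l, Γ F G k k l p * Γ F G l i j p)
    - (∑ k, ∑ l, Γ F G k j l p * Γ F G l i k p)

/-- Scalar curvature `Scal = g^{ij} R_{ij}`. -/
def scal (F G : ℝ → ℝ) (p : V4) : ℝ :=
  ∑ i, ∑ j, (gm F G p)⁻¹ i j * ricci F G i j p

section PartialDerivatives

/-- `f` is differentiable at `p` with partial derivatives `a`, `b`, `0`, `0`. -/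
def HasPd (f : V4 → ℝ) (a b : ℝ) (p : V4) : Prop :=
  HasFDerivAt f (a • (ContinuousLinearMap.proj 0 : V4 →L[ℝ] ℝ) +
    b • (ContinuousLinearMap.proj 1 : V4 →L[ℝ] ℝ)) p

variable {f g : V4 → ℝ} {a b a' b' : ℝ} {p : V4}

lemma HasPd.pd_eq (h : HasPd f a b p) (i : Fin 4) : pd i f p = ![a, b, 0, 0] i := by
  have h' : HasFDerivAt f _ p := h
  fin_cases i <;> simp [pd, h'.fderiv]

lemma HasPd.congr (h : HasPd f a b p) (hfg : g =ᶠ[nhds p] f) : HasPd g a b p :=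
  HasFDerivAt.congr_of_eventuallyEq h hfg

lemma hasPd_const (c : ℝ) : HasPd (fun _ => c) 0 0 p := by
  simpa [HasPd] using hasFDerivAt_const c p

lemma hasPd_comp_coord_zero {φ : ℝ → ℝ} (hφ : DifferentiableAt ℝ φ (p 0)) :
    HasPd (fun q => φ (q 0)) (deriv φ (p 0)) 0 p := by
  have h := hφ.hasDerivAt.comp_hasFDerivAt p
    (ContinuousLinearMap.proj 0 : V4 →L[ℝ] ℝ).hasFDerivAt
  exact h.congr_fderiv (by simp)

lemma hasPd_comp_coord_one {φ : ℝ → ℝ} (hφ : DifferentiableAt ℝ φ (p 1)) :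
    HasPd (fun q => φ (q 1)) 0 (deriv φ (p 1)) p := by
  have h := hφ.hasDerivAt.comp_hasFDerivAt p
    (ContinuousLinearMap.proj 1 : V4 →L[ℝ] ℝ).hasFDerivAt
  exact h.congr_fderiv (by simp)

lemma hasPd_coord_zero : HasPd (fun q => q 0) 1 0 p := by
  simpa using hasPd_comp_coord_zero (p := p) (φ := fun x => x) differentiableAt_fun_id

lemma hasPd_coord_one : HasPd (fun q => q 1) 0 1 p := by
  simpa using hasPd_comp_coord_one (p := p) (φ := fun x => x) differentiableAt_fun_id

lemma HasPd.neg (hf : HasPd f a b p) : HasPd (fun q => -f q) (-a) (-b) p :=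
  (HasFDerivAt.fun_neg hf).congr_fderiv (by ext v; simp; ring)

lemma HasPd.add (hf : HasPd f a b p) (hg : HasPd g a' b' p) :
    HasPd (fun q => f q + g q) (a + a') (b + b') p :=
  (HasFDerivAt.fun_add hf hg).congr_fderiv (by ext v; simp; ring)

lemma HasPd.sub (hf : HasPd f a b p) (hg : HasPd g a' b' p) :
    HasPd (fun q => f q - g q) (a - a') (b - b') p :=
  (HasFDerivAt.fun_sub hf hg).congr_fderiv (by ext v; simp; ring)

lemma HasPd.mul (hf : HasPd f a b p) (hg : HasPd g a' b' p) :
    HasPd (fun q => f q * g q) (a * g p + f p * a') (b * g p + f p * b') p :=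
  (HasFDerivAt.fun_mul hf hg).congr_fderiv (by ext v; simp; ring)

lemma HasPd.pow (hf : HasPd f a b p) (n : ℕ) :
    HasPd (fun q => f q ^ n) (n * f p ^ (n - 1) * a) (n * f p ^ (n - 1) * b) p :=
  (HasFDerivAt.pow hf n).congr_fderiv (by ext v; simp; ring)

lemma HasPd.div (hf : HasPd f a b p) (hg : HasPd g a' b' p) (h : g p ≠ 0) :
    HasPd (fun q => f q / g q) ((a * g p - f p * a') / g p ^ 2)
      ((b * g p - f p * b') / g p ^ 2) p := by
  have hinv : HasFDerivAt (fun q => (g q)⁻¹) _ p := (hasDerivAt_inv h).comp_hasFDerivAt p hg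
  simp only [div_eq_mul_inv]
  refine (HasFDerivAt.fun_mul hf hinv).congr_fderiv ?_
  ext v
  simp
  field_simp
  ring

end PartialDerivatives

/-- The entries of the inverse of the ortho-toric metric. -/
def inverseMetric (x y f g : ℝ) : Matrix (Fin 4) (Fin 4) ℝ :=
  !![f / (x - y), 0, 0, 0;
     0, -(g / (x - y)), 0, 0;
     0, 0, (x ^ 2 / f - y ^ 2 / g) / (x - y), (y / g - x / f) / (x - y);
     0, 0, (y / g - x / f) / (x - y), (1 / f - 1 / g) / (x - y)]

/-- The `ξ`- and `η`-derivatives of the ortho-toric metric, the other two being zero;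
`f'` and `g'` stand for the derivatives of `F` and `G`. -/
def metricDeriv (x y f f' g g' : ℝ) : Fin 4 → Matrix (Fin 4) (Fin 4) ℝ
  | 0 => !![(f - (x - y) * f') / f ^ 2, 0, 0, 0;
       0, -(1 / g), 0, 0;
       0, 0, (f' * (x - y) - f + g) / (x - y) ^ 2,
         y * (f' * (x - y) - f + g) / (x - y) ^ 2;
       0, 0, y * (f' * (x - y) - f + g) / (x - y) ^ 2,
         y ^ 2 * (f' * (x - y) - f + g) / (x - y) ^ 2 - g]
  | 1 => !![-(1 / f), 0, 0, 0;
       0, (g + (x - y) * g') / g ^ 2, 0, 0;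
       0, 0, (f - g - g' * (x - y)) / (x - y) ^ 2,
         x * (f - g - g' * (x - y)) / (x - y) ^ 2;
       0, 0, x * (f - g - g' * (x - y)) / (x - y) ^ 2,
         x ^ 2 * (f - g - g' * (x - y)) / (x - y) ^ 2 - f]
  | _ => 0

/-- Closed form of the Christoffel symbols of the ortho-toric metric, upper index first. -/
def christoffel (x y f f' g g' : ℝ) : Fin 4 → Matrix (Fin 4) (Fin 4) ℝ
  | 0 => !![1 / (2 * (x - y)) - f' / (2 * f), -(1 / (2 * (x - y))), 0, 0;
       -(1 / (2 * (x - y))), f / (2 * (x - y) * g), 0, 0;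
       0, 0, -(f * (f' * (x - y) - f + g) / (2 * (x - y) ^ 3)),
         -(f * y * (f' * (x - y) - f + g) / (2 * (x - y) ^ 3));
       0, 0, -(f * y * (f' * (x - y) - f + g) / (2 * (x - y) ^ 3)),
         -(f * (y ^ 2 * (f' * (x - y) - f + g) - g * (x - y) ^ 2) / (2 * (x - y) ^ 3))]
  | 1 => !![-(g / (2 * (x - y) * f)), 1 / (2 * (x - y)), 0, 0;
       1 / (2 * (x - y)), -(1 / (2 * (x - y))) - g' / (2 * g), 0, 0;
       0, 0, g * (f - g - g' * (x - y)) / (2 * (x - y) ^ 3),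
         g * x * (f - g - g' * (x - y)) / (2 * (x - y) ^ 3);
       0, 0, g * x * (f - g - g' * (x - y)) / (2 * (x - y) ^ 3),
         g * (x ^ 2 * (f - g - g' * (x - y)) - f * (x - y) ^ 2) / (2 * (x - y) ^ 3)]
  | 2 => !![0, 0, x * (f' * (x - y) - f + g) / (2 * (x - y) ^ 2 * f),
         (x * y * (f' * (x - y) - f + g) + (x - y) * (g * x - f * y)) / (2 * (x - y) ^ 2 * f);
       0, 0, y * (f - g - g' * (x - y)) / (2 * (x - y) ^ 2 * g),
         (x * y * (f - g - g' * (x - y)) + (x - y) * (g * x - f * y)) / (2 * (x - y) ^ 2 * g);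
       x * (f' * (x - y) - f + g) / (2 * (x - y) ^ 2 * f),
         y * (f - g - g' * (x - y)) / (2 * (x - y) ^ 2 * g), 0, 0;
       (x * y * (f' * (x - y) - f + g) + (x - y) * (g * x - f * y)) / (2 * (x - y) ^ 2 * f),
         (x * y * (f - g - g' * (x - y)) + (x - y) * (g * x - f * y)) / (2 * (x - y) ^ 2 * g),
         0, 0]
  | 3 => !![0, 0, -((f' * (x - y) - f + g) / (2 * (x - y) ^ 2 * f)),
         ((x - y) * (f - g) - y * (f' * (x - y) - f + g)) / (2 * (x - y) ^ 2 * f);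
       0, 0, -((f - g - g' * (x - y)) / (2 * (x - y) ^ 2 * g)),
         ((x - y) * (f - g) - x * (f - g - g' * (x - y))) / (2 * (x - y) ^ 2 * g);
       -((f' * (x - y) - f + g) / (2 * (x - y) ^ 2 * f)),
         -((f - g - g' * (x - y)) / (2 * (x - y) ^ 2 * g)), 0, 0;
       ((x - y) * (f - g) - y * (f' * (x - y) - f + g)) / (2 * (x - y) ^ 2 * f),
         ((x - y) * (f - g) - x * (f - g - g' * (x - y))) / (2 * (x - y) ^ 2 * g), 0, 0]

section OrthoToric

variable {F G : ℝ → ℝ} {p : V4}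

lemma gm_inv (hu : p 0 - p 1 ≠ 0) (hf : F (p 0) ≠ 0) (hg : G (p 1) ≠ 0) :
    (gm F G p)⁻¹ = inverseMetric (p 0) (p 1) (F (p 0)) (G (p 1)) := by
  apply Matrix.inv_eq_right_inv
  ext i j
  fin_cases i <;> fin_cases j <;>
    simp [gm, inverseMetric, Matrix.mul_apply, Fin.sum_univ_four] <;> field_simp <;> ring

lemma pd_gm (hF : Differentiable ℝ F) (hG : Differentiable ℝ G)
    (hu : p 0 - p 1 ≠ 0) (hf : F (p 0) ≠ 0) (hg : G (p 1) ≠ 0) (i j l : Fin 4) :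
    pd i (fun q => gm F G q j l) p =
      metricDeriv (p 0) (p 1) (F (p 0)) (deriv F (p 0)) (G (p 1)) (deriv G (p 1)) i j l := by
  have x := hasPd_coord_zero (p := p)
  have y := hasPd_coord_one (p := p)
  have f := hasPd_comp_coord_zero (hF (p 0))
  have g := hasPd_comp_coord_one (hG (p 1))
  have u := x.sub y
  have hzero : pd i (fun _ => 0) p = 0 := by simp [pd]
  have h00 := (u.div f hf).pd_eq i
  have h11 := (u.div g hg).neg.pd_eq i
  have h22 := ((f.sub g).div u hu).pd_eq i
  have h23 := (((f.mul y).sub (g.mul x)).div u hu).pd_eq i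
  have h33 := (((f.mul (y.pow 2)).sub (g.mul (x.pow 2))).div u hu).pd_eq i
  fin_cases j <;> fin_cases l <;> [
      refine h00.trans ?_; refine hzero.trans ?_; refine hzero.trans ?_; refine hzero.trans ?_;
      refine hzero.trans ?_; refine h11.trans ?_; refine hzero.trans ?_; refine hzero.trans ?_;
      refine hzero.trans ?_; refine hzero.trans ?_; refine h22.trans ?_; refine h23.trans ?_;
      refine hzero.trans ?_; refine hzero.trans ?_; refine h23.trans ?_; refine h33.trans ?_] <;>
    fin_cases i <;> simp [metricDeriv] <;> field_simp <;> ring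

lemma Γ_eq_christoffel (hF : Differentiable ℝ F) (hG : Differentiable ℝ G)
    (hu : p 0 - p 1 ≠ 0) (hf : F (p 0) ≠ 0) (hg : G (p 1) ≠ 0) (k i j : Fin 4) :
    Γ F G k i j p =
      christoffel (p 0) (p 1) (F (p 0)) (deriv F (p 0)) (G (p 1)) (deriv G (p 1)) k i j := by
  simp only [Γ, gm_inv hu hf hg, pd_gm hF hG hu hf hg, Fin.sum_univ_four]
  fin_cases k <;> fin_cases i <;> fin_cases j <;>
    simp [inverseMetric, metricDeriv, christoffel] <;> field_simp <;> ring

lemma hasPd_Γ (hF : ContDiff ℝ 2 F) (hG : ContDiff ℝ 2 G)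
    (hu : p 0 - p 1 ≠ 0) (hf : F (p 0) ≠ 0) (hg : G (p 1) ≠ 0) {k i j : Fin 4} {a b : ℝ}
    (h : HasPd (fun q => christoffel (q 0) (q 1) (F (q 0)) (deriv F (q 0)) (G (q 1))
      (deriv G (q 1)) k i j) a b p) :
    HasPd (Γ F G k i j) a b p := by
  have hF' := hF.differentiable two_ne_zero
  have hG' := hG.differentiable two_ne_zero
  refine h.congr ?_
  have cu : Continuous fun q : V4 => q 0 - q 1 := by fun_prop
  have cf : Continuous fun q : V4 => F (q 0) := hF.continuous.comp (continuous_apply 0)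
  have cg : Continuous fun q : V4 => G (q 1) := hG.continuous.comp (continuous_apply 1)
  filter_upwards [cu.continuousAt.eventually_ne hu, cf.continuousAt.eventually_ne hf,
    cg.continuousAt.eventually_ne hg] with q hu hf hg
  exact Γ_eq_christoffel hF' hG' hu hf hg k i j

lemma pd_Γ_eq_zero (hF : ContDiff ℝ 2 F) (hG : ContDiff ℝ 2 G)
    (hu : p 0 - p 1 ≠ 0) (hf : F (p 0) ≠ 0) (hg : G (p 1) ≠ 0) {k i j : Fin 4}
    (h : ∀ x y f f' g g', christoffel x y f f' g g' k i j = 0) (m : Fin 4) :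
    pd m (Γ F G k i j) p = 0 := by
  have h0 : HasPd (Γ F G k i j) 0 0 p :=
    hasPd_Γ hF hG hu hf hg (by simpa only [h] using hasPd_const 0)
  rw [h0.pd_eq]
  fin_cases m <;> rfl

/-- The Ricci eigenvalue on the `ξ`-plane; `f''` stands for the second derivative of `F`. -/
def ricciEigenvalueXi (x y f' f'' g' : ℝ) : ℝ :=
  -(f'' / (2 * (x - y))) + (f' - g') / (2 * (x - y) ^ 2)

/-- The Ricci eigenvalue on the `η`-plane; `g''` stands for the second derivative of `G`. -/
def ricciEigenvalueEta (x y f' g' g'' : ℝ) : ℝ :=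
  g'' / (2 * (x - y)) - (f' - g') / (2 * (x - y) ^ 2)

lemma ricci_zero_zero (hF : ContDiff ℝ 2 F) (hG : ContDiff ℝ 2 G)
    (hu : p 0 - p 1 ≠ 0) (hf : F (p 0) ≠ 0) (hg : G (p 1) ≠ 0) :
    ricci F G 0 0 p =
      ricciEigenvalueXi (p 0) (p 1) (deriv F (p 0)) (deriv (deriv F) (p 0)) (deriv G (p 1)) *
        ((p 0 - p 1) / F (p 0)) := by
  have x := hasPd_coord_zero (p := p)
  have y := hasPd_coord_one (p := p)
  have f := hasPd_comp_coord_zero (hF.differentiable (by simp) (p 0))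
  have g := hasPd_comp_coord_one (hG.differentiable (by simp) (p 1))
  have f' := hasPd_comp_coord_zero (hF.differentiable_deriv_two (p 0))
  have u := x.sub y
  have one := hasPd_const (p := p) 1
  have two := hasPd_const (p := p) 2
  have K := ((f'.mul u).sub f).add g
  have u₁ := two.mul u
  have u₂ := two.mul (u.pow 2)
  have hu₁ : 2 * (p 0 - p 1) ≠ 0 := by positivity
  have hu₂ : 2 * (p 0 - p 1) ^ 2 ≠ 0 := by positivity
  have h0_000 := (hasPd_Γ (k := 0) (i := 0) (j := 0) hF hG hu hf hg
    ((one.div u₁ hu₁).sub (f'.div (two.mul f) (mul_ne_zero two_ne_zero hf)))).pd_eq 0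
  have h1_100 := (hasPd_Γ (k := 1) (i := 0) (j := 0) hF hG hu hf hg
    ((g.div (u₁.mul f) (mul_ne_zero hu₁ hf)).neg)).pd_eq 1
  have h0_101 := (hasPd_Γ (k := 1) (i := 0) (j := 1) hF hG hu hf hg
    (one.div u₁ hu₁)).pd_eq 0
  have h0_202 := (hasPd_Γ (k := 2) (i := 0) (j := 2) hF hG hu hf hg
    ((x.mul K).div (u₂.mul f) (mul_ne_zero hu₂ hf))).pd_eq 0
  have h0_303 := (hasPd_Γ (k := 3) (i := 0) (j := 3) hF hG hu hf hg
    (((u.mul (f.sub g)).sub (y.mul K)).div (u₂.mul f) (mul_ne_zero hu₂ hf))).pd_eq 0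
  have hz := @pd_Γ_eq_zero F G p hF hG hu hf hg
  have hΓ :=
    Γ_eq_christoffel (hF.differentiable two_ne_zero) (hG.differentiable two_ne_zero) hu hf hg
  simp [ricci, Fin.sum_univ_four, h0_000, h1_100, h0_101, h0_202, h0_303, hz, hΓ, christoffel,
    ricciEigenvalueXi]
  field_simp
  ring

lemma ricci_one_one (hF : ContDiff ℝ 2 F) (hG : ContDiff ℝ 2 G)
    (hu : p 0 - p 1 ≠ 0) (hf : F (p 0) ≠ 0) (hg : G (p 1) ≠ 0) :
    ricci F G 1 1 p =
      ricciEigenvalueEta (p 0) (p 1) (deriv F (p 0)) (deriv G (p 1)) (deriv (deriv G) (p 1)) *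
        -((p 0 - p 1) / G (p 1)) := by
  have x := hasPd_coord_zero (p := p)
  have y := hasPd_coord_one (p := p)
  have f := hasPd_comp_coord_zero (hF.differentiable (by simp) (p 0))
  have g := hasPd_comp_coord_one (hG.differentiable (by simp) (p 1))
  have g' := hasPd_comp_coord_one (hG.differentiable_deriv_two (p 1))
  have u := x.sub y
  have one := hasPd_const (p := p) 1
  have two := hasPd_const (p := p) 2
  have L := (f.sub g).sub (g'.mul u)
  have u₁ := two.mul u
  have u₂ := two.mul (u.pow 2)
  have hu₁ : 2 * (p 0 - p 1) ≠ 0 := by positivity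
  have hu₂ : 2 * (p 0 - p 1) ^ 2 ≠ 0 := by positivity
  have h0_011 := (hasPd_Γ (k := 0) (i := 1) (j := 1) hF hG hu hf hg
    (f.div (u₁.mul g) (mul_ne_zero hu₁ hg))).pd_eq 0
  have h1_111 := (hasPd_Γ (k := 1) (i := 1) (j := 1) hF hG hu hf hg
    ((one.div u₁ hu₁).neg.sub (g'.div (two.mul g) (mul_ne_zero two_ne_zero hg)))).pd_eq 1
  have h1_010 := (hasPd_Γ (k := 0) (i := 1) (j := 0) hF hG hu hf hg
    ((one.div u₁ hu₁).neg)).pd_eq 1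
  have h1_212 := (hasPd_Γ (k := 2) (i := 1) (j := 2) hF hG hu hf hg
    ((y.mul L).div (u₂.mul g) (mul_ne_zero hu₂ hg))).pd_eq 1
  have h1_313 := (hasPd_Γ (k := 3) (i := 1) (j := 3) hF hG hu hf hg
    (((u.mul (f.sub g)).sub (x.mul L)).div (u₂.mul g) (mul_ne_zero hu₂ hg))).pd_eq 1
  have hz := @pd_Γ_eq_zero F G p hF hG hu hf hg
  have hΓ :=
    Γ_eq_christoffel (hF.differentiable two_ne_zero) (hG.differentiable two_ne_zero) hu hf hg
  simp [ricci, Fin.sum_univ_four, h0_011, h1_111, h1_010, h1_212, h1_313, hz, hΓ, christoffel,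
    ricciEigenvalueEta]
  field_simp
  ring

lemma ricci_two_two (hF : ContDiff ℝ 2 F) (hG : ContDiff ℝ 2 G)
    (hu : p 0 - p 1 ≠ 0) (hf : F (p 0) ≠ 0) (hg : G (p 1) ≠ 0) :
    ricci F G 2 2 p =
      ricciEigenvalueXi (p 0) (p 1) (deriv F (p 0)) (deriv (deriv F) (p 0)) (deriv G (p 1)) *
          (F (p 0) / (p 0 - p 1)) -
        ricciEigenvalueEta (p 0) (p 1) (deriv F (p 0)) (deriv G (p 1)) (deriv (deriv G) (p 1)) *
          (G (p 1) / (p 0 - p 1)) := by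
  have x := hasPd_coord_zero (p := p)
  have y := hasPd_coord_one (p := p)
  have f := hasPd_comp_coord_zero (hF.differentiable (by simp) (p 0))
  have g := hasPd_comp_coord_one (hG.differentiable (by simp) (p 1))
  have f' := hasPd_comp_coord_zero (hF.differentiable_deriv_two (p 0))
  have g' := hasPd_comp_coord_one (hG.differentiable_deriv_two (p 1))
  have u := x.sub y
  have two := hasPd_const (p := p) 2
  have K := ((f'.mul u).sub f).add g
  have L := (f.sub g).sub (g'.mul u)
  have u₃ := two.mul (u.pow 3)
  have hu₃ : 2 * (p 0 - p 1) ^ 3 ≠ 0 := by positivity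
  have h0_022 := (hasPd_Γ (k := 0) (i := 2) (j := 2) hF hG hu hf hg
    (((f.mul K).div u₃ hu₃).neg)).pd_eq 0
  have h1_122 := (hasPd_Γ (k := 1) (i := 2) (j := 2) hF hG hu hf hg
    ((g.mul L).div u₃ hu₃)).pd_eq 1
  have hz := @pd_Γ_eq_zero F G p hF hG hu hf hg
  have hΓ :=
    Γ_eq_christoffel (hF.differentiable two_ne_zero) (hG.differentiable two_ne_zero) hu hf hg
  simp [ricci, Fin.sum_univ_four, h0_022, h1_122, hz, hΓ, christoffel,
    ricciEigenvalueXi, ricciEigenvalueEta]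
  field_simp
  ring

lemma ricci_two_three (hF : ContDiff ℝ 2 F) (hG : ContDiff ℝ 2 G)
    (hu : p 0 - p 1 ≠ 0) (hf : F (p 0) ≠ 0) (hg : G (p 1) ≠ 0) :
    ricci F G 2 3 p =
      ricciEigenvalueXi (p 0) (p 1) (deriv F (p 0)) (deriv (deriv F) (p 0)) (deriv G (p 1)) *
          (F (p 0) * p 1 / (p 0 - p 1)) -
        ricciEigenvalueEta (p 0) (p 1) (deriv F (p 0)) (deriv G (p 1)) (deriv (deriv G) (p 1)) *
          (G (p 1) * p 0 / (p 0 - p 1)) := by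
  have x := hasPd_coord_zero (p := p)
  have y := hasPd_coord_one (p := p)
  have f := hasPd_comp_coord_zero (hF.differentiable (by simp) (p 0))
  have g := hasPd_comp_coord_one (hG.differentiable (by simp) (p 1))
  have f' := hasPd_comp_coord_zero (hF.differentiable_deriv_two (p 0))
  have g' := hasPd_comp_coord_one (hG.differentiable_deriv_two (p 1))
  have u := x.sub y
  have two := hasPd_const (p := p) 2
  have K := ((f'.mul u).sub f).add g
  have L := (f.sub g).sub (g'.mul u)
  have u₃ := two.mul (u.pow 3)
  have hu₃ : 2 * (p 0 - p 1) ^ 3 ≠ 0 := by positivity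
  have h0_023 := (hasPd_Γ (k := 0) (i := 2) (j := 3) hF hG hu hf hg
    ((((f.mul y).mul K).div u₃ hu₃).neg)).pd_eq 0
  have h1_123 := (hasPd_Γ (k := 1) (i := 2) (j := 3) hF hG hu hf hg
    (((g.mul x).mul L).div u₃ hu₃)).pd_eq 1
  have hz := @pd_Γ_eq_zero F G p hF hG hu hf hg
  have hΓ :=
    Γ_eq_christoffel (hF.differentiable two_ne_zero) (hG.differentiable two_ne_zero) hu hf hg
  simp [ricci, Fin.sum_univ_four, h0_023, h1_123, hz, hΓ, christoffel,
    ricciEigenvalueXi, ricciEigenvalueEta]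
  field_simp
  ring

lemma ricci_three_two (hF : ContDiff ℝ 2 F) (hG : ContDiff ℝ 2 G)
    (hu : p 0 - p 1 ≠ 0) (hf : F (p 0) ≠ 0) (hg : G (p 1) ≠ 0) :
    ricci F G 3 2 p =
      ricciEigenvalueXi (p 0) (p 1) (deriv F (p 0)) (deriv (deriv F) (p 0)) (deriv G (p 1)) *
          (F (p 0) * p 1 / (p 0 - p 1)) -
        ricciEigenvalueEta (p 0) (p 1) (deriv F (p 0)) (deriv G (p 1)) (deriv (deriv G) (p 1)) *
          (G (p 1) * p 0 / (p 0 - p 1)) := by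
  have x := hasPd_coord_zero (p := p)
  have y := hasPd_coord_one (p := p)
  have f := hasPd_comp_coord_zero (hF.differentiable (by simp) (p 0))
  have g := hasPd_comp_coord_one (hG.differentiable (by simp) (p 1))
  have f' := hasPd_comp_coord_zero (hF.differentiable_deriv_two (p 0))
  have g' := hasPd_comp_coord_one (hG.differentiable_deriv_two (p 1))
  have u := x.sub y
  have two := hasPd_const (p := p) 2
  have K := ((f'.mul u).sub f).add g
  have L := (f.sub g).sub (g'.mul u)
  have u₃ := two.mul (u.pow 3)
  have hu₃ : 2 * (p 0 - p 1) ^ 3 ≠ 0 := by positivity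
  have h0_032 := (hasPd_Γ (k := 0) (i := 3) (j := 2) hF hG hu hf hg
    ((((f.mul y).mul K).div u₃ hu₃).neg)).pd_eq 0
  have h1_132 := (hasPd_Γ (k := 1) (i := 3) (j := 2) hF hG hu hf hg
    (((g.mul x).mul L).div u₃ hu₃)).pd_eq 1
  have hz := @pd_Γ_eq_zero F G p hF hG hu hf hg
  have hΓ :=
    Γ_eq_christoffel (hF.differentiable two_ne_zero) (hG.differentiable two_ne_zero) hu hf hg
  simp [ricci, Fin.sum_univ_four, h0_032, h1_132, hz, hΓ, christoffel,
    ricciEigenvalueXi, ricciEigenvalueEta]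
  field_simp
  ring

lemma ricci_three_three (hF : ContDiff ℝ 2 F) (hG : ContDiff ℝ 2 G)
    (hu : p 0 - p 1 ≠ 0) (hf : F (p 0) ≠ 0) (hg : G (p 1) ≠ 0) :
    ricci F G 3 3 p =
      ricciEigenvalueXi (p 0) (p 1) (deriv F (p 0)) (deriv (deriv F) (p 0)) (deriv G (p 1)) *
          (F (p 0) * p 1 ^ 2 / (p 0 - p 1)) -
        ricciEigenvalueEta (p 0) (p 1) (deriv F (p 0)) (deriv G (p 1)) (deriv (deriv G) (p 1)) *
          (G (p 1) * p 0 ^ 2 / (p 0 - p 1)) := by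
  have x := hasPd_coord_zero (p := p)
  have y := hasPd_coord_one (p := p)
  have f := hasPd_comp_coord_zero (hF.differentiable (by simp) (p 0))
  have g := hasPd_comp_coord_one (hG.differentiable (by simp) (p 1))
  have f' := hasPd_comp_coord_zero (hF.differentiable_deriv_two (p 0))
  have g' := hasPd_comp_coord_one (hG.differentiable_deriv_two (p 1))
  have u := x.sub y
  have two := hasPd_const (p := p) 2
  have K := ((f'.mul u).sub f).add g
  have L := (f.sub g).sub (g'.mul u)
  have u₃ := two.mul (u.pow 3)
  have hu₃ : 2 * (p 0 - p 1) ^ 3 ≠ 0 := by positivity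
  have h0_033 := (hasPd_Γ (k := 0) (i := 3) (j := 3) hF hG hu hf hg
    (((f.mul (((y.pow 2).mul K).sub (g.mul (u.pow 2)))).div u₃ hu₃).neg)).pd_eq 0
  have h1_133 := (hasPd_Γ (k := 1) (i := 3) (j := 3) hF hG hu hf hg
    ((g.mul (((x.pow 2).mul L).sub (f.mul (u.pow 2)))).div u₃ hu₃)).pd_eq 1
  have hz := @pd_Γ_eq_zero F G p hF hG hu hf hg
  have hΓ :=
    Γ_eq_christoffel (hF.differentiable two_ne_zero) (hG.differentiable two_ne_zero) hu hf hg
  simp [ricci, Fin.sum_univ_four, h0_033, h1_133, hz, hΓ, christoffel,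
    ricciEigenvalueXi, ricciEigenvalueEta]
  field_simp
  ring

end OrthoToric

/-- The normalized scalar curvature of the ortho-toric Kähler metric is
`s = -(F''(ξ) - G''(η)) / (6(ξ - η))`. -/
theorem stmt10 (F G : ℝ → ℝ) (hF : ContDiff ℝ (⊤ : ℕ∞) F) (hG : ContDiff ℝ (⊤ : ℕ∞) G)
    (p : V4) (h1 : p 1 < p 0) (h2 : 0 < F (p 0)) (h3 : G (p 1) < 0) :
    scal F G p / 6
      = -(deriv (deriv F) (p 0) - deriv (deriv G) (p 1)) / (6 * (p 0 - p 1)) := by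
  have hF2 : ContDiff ℝ 2 F := hF.of_le (WithTop.coe_le_coe.mpr le_top)
  have hG2 : ContDiff ℝ 2 G := hG.of_le (WithTop.coe_le_coe.mpr le_top)
  have hu : p 0 - p 1 ≠ 0 := (sub_pos.mpr h1).ne'
  have hf := h2.ne'
  have hg := h3.ne
  simp [scal, Fin.sum_univ_four, gm_inv hu hf hg, inverseMetric,
    ricci_zero_zero hF2 hG2 hu hf hg, ricci_one_one hF2 hG2 hu hf hg,
    ricci_two_two hF2 hG2 hu hf hg, ricci_two_three hF2 hG2 hu hf hg,
    ricci_three_two hF2 hG2 hu hf hg, ricci_three_three hF2 hG2 hu hf hg,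
    ricciEigenvalueXi, ricciEigenvalueEta]
  field_simp
  ring
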